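/- arXiv:1702.03919 — 3 statements merged into one kernel-verified Lean document; each statement's English description precedes it below -/
import Mathlib

section
/- Let K be an algebraically closed field of characteristic zero and let a, b, j₁, j₂ ∈ K satisfy 110592·a³ = −j₁j₂ and 746496·b² = (j₁−1728)(j₂−1728). Then the polynomial (X³ + aX + b + 2)(X³ + aX + b − 2) ∈ K[X] has a repeated root if and only if j₁ = j₂. -/
open Polynomial

/-- The product of the discriminants of `X³ + aX + b ± 2` is `(j₁ - j₂)² / 256`. -/
lemma discr_mul_discr_eq {K : Type*} [Field K] [CharZero K] {a b j1 j2 : K}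
    (ha : 110592 * a ^ 3 = -(j1 * j2))
    (hb : 746496 * b ^ 2 = (j1 - 1728) * (j2 - 1728)) :
    256 * ((4 * a ^ 3 + 27 * (b + 2) ^ 2) * (4 * a ^ 3 + 27 * (b - 2) ^ 2)) =
      (j1 - j2) ^ 2 := by
  have ha' : a ^ 3 = -(j1 * j2) / 110592 := by
    rw [← ha]; ring
  have hb' : b ^ 2 = (j1 - 1728) * (j2 - 1728) / 746496 := by
    rw [← hb]; ring
  have h : (4 * a ^ 3 + 27 * (b + 2) ^ 2) * (4 * a ^ 3 + 27 * (b - 2) ^ 2) =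
      (4 * a ^ 3 + 27 * b ^ 2 + 108) ^ 2 - 11664 * b ^ 2 := by ring
  rw [h, ha', hb']
  ring

/-- A depressed cubic with vanishing discriminant has a double root. -/
lemma exists_sq_dvd_depressed_cubic {K : Type*} [Field K] [CharZero K] {a c : K}
    (h : 4 * a ^ 3 + 27 * c ^ 2 = 0) :
    ∃ x : K, (X - C x) ^ 2 ∣ X ^ 3 + C a * X + C c := by
  obtain ⟨x, rfl, rfl⟩ : ∃ x : K, a = -3 * x ^ 2 ∧ c = 2 * x ^ 3 := by
    by_cases ha : a = 0
    · subst ha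
      exact ⟨0, by simp, by simpa using h⟩
    · refine ⟨-3 * c / (2 * a), ?_, ?_⟩
      · field_simp
        linear_combination h
      · field_simp
        linear_combination c * h
  refine ⟨x, X + C (2 * x), ?_⟩
  simp only [map_mul, map_pow, map_neg, map_ofNat]
  ring

lemma discr_eq_zero_of_common_root {K : Type*} [Field K] {a c x : K}
    (h : x ^ 3 + a * x + c = 0) (h' : 3 * x ^ 2 + a = 0) :
    4 * a ^ 3 + 27 * c ^ 2 = 0 := by
  obtain rfl : a = -3 * x ^ 2 := by linear_combination h'
  obtain rfl : c = 2 * x ^ 3 := by linear_combination h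
  ring

theorem repeated_root_iff_j_eq {K : Type*} [Field K] [IsAlgClosed K] [CharZero K]
    (a b j1 j2 : K)
    (ha : 110592 * a ^ 3 = -(j1 * j2))
    (hb : 746496 * b ^ 2 = (j1 - 1728) * (j2 - 1728)) :
    (∃ x : K, (X - C x) ^ 2 ∣
        (X ^ 3 + C a * X + C (b + 2)) * (X ^ 3 + C a * X + C (b - 2))) ↔ j1 = j2 := by
  have key := discr_mul_discr_eq ha hb
  constructor
  · rintro ⟨x, q, hq⟩
    have h0 : (x ^ 3 + a * x + (b + 2)) * (x ^ 3 + a * x + (b - 2)) = 0 := by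
      simpa using congrArg (eval x) hq
    have h1 : (3 * x ^ 2 + a) * (x ^ 3 + a * x + (b - 2)) +
        (x ^ 3 + a * x + (b + 2)) * (3 * x ^ 2 + a) = 0 := by
      simpa [derivative_mul, derivative_pow] using congrArg (fun p => eval x (derivative p)) hq
    have h4 : (4 : K) ≠ 0 := by norm_num
    have hd : (4 * a ^ 3 + 27 * (b + 2) ^ 2) * (4 * a ^ 3 + 27 * (b - 2) ^ 2) = 0 := by
      rcases mul_eq_zero.mp h0 with h | h
      · refine mul_eq_zero_of_left (discr_eq_zero_of_common_root h ?_) _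
        refine (mul_eq_zero.mp ?_).resolve_left h4
        linear_combination 2 * (3 * x ^ 2 + a) * h - h1
      · refine mul_eq_zero_of_right _ (discr_eq_zero_of_common_root h ?_)
        refine (mul_eq_zero.mp ?_).resolve_left h4
        linear_combination h1 - 2 * (3 * x ^ 2 + a) * h
    rw [hd, mul_zero] at key
    exact sub_eq_zero.mp (pow_eq_zero_iff two_ne_zero |>.mp key.symm)
  · rintro rfl
    rw [sub_self, zero_pow two_ne_zero] at key
    rcases mul_eq_zero.mp ((mul_eq_zero.mp key).resolve_left (by norm_num)) with h | h
    · obtain ⟨x, hx⟩ := exists_sq_dvd_depressed_cubic h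
      exact ⟨x, hx.mul_right _⟩
    · obtain ⟨x, hx⟩ := exists_sq_dvd_depressed_cubic h
      exact ⟨x, hx.mul_left _⟩
end

section
/- Let K be a field and λ₁, λ₂ ∈ K. Define Q₂(u₁,v₁,u₂,v₂) := λ₁(λ₁−1)v₁²v₂² + λ₁(λ₁λ₂−2λ₁+1)v₁²u₂v₂ − λ₁(λ₁−1)u₁v₁v₂² + (2λ₁²−2λ₁λ₂−λ₁+1)u₁v₁u₂v₂ − (λ₁−1)²u₁v₁u₂² + (λ₂−1)u₁²u₂v₂. Then Q₂ vanishes at the five points (u₁,v₁,u₂,v₂) = (1,0,0,1), (1,1,0,1), (0,1,1,0), (1,0,1,0), (1,1,λ₂,1), and at the point (λ₁,1,1,1) both Q₂ and all four of its partial derivatives ∂Q₂/∂u₁, ∂Q₂/∂v₁, ∂Q₂/∂u₂, ∂Q₂/∂v₂ vanish (i.e. Q₂ vanishes to order two there). -/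
/- STATEMENT 15: vanishing properties of the bidegree-(2,2) polynomial Q₂ cutting
   out the curve C₂ on ℙ¹ × ℙ¹. Variables: u₁ = X 0, v₁ = X 1, u₂ = X 2, v₂ = X 3. -/

open MvPolynomial

/-- The polynomial `Q₂ ∈ K[u₁,v₁,u₂,v₂]`. -/
noncomputable def Q₂ {K : Type*} [Field K] (l1 l2 : K) : MvPolynomial (Fin 4) K :=
  C (l1 * (l1 - 1)) * X 1 ^ 2 * X 3 ^ 2
    + C (l1 * (l1 * l2 - 2 * l1 + 1)) * X 1 ^ 2 * X 2 * X 3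
    - C (l1 * (l1 - 1)) * X 0 * X 1 * X 3 ^ 2
    + C (2 * l1 ^ 2 - 2 * l1 * l2 - l1 + 1) * X 0 * X 1 * X 2 * X 3
    - C ((l1 - 1) ^ 2) * X 0 * X 1 * X 2 ^ 2
    + C (l2 - 1) * X 0 ^ 2 * X 2 * X 3

/-- `Q₂` vanishes at the five points `(1,0,0,1)`, `(1,1,0,1)`, `(0,1,1,0)`,
`(1,0,1,0)`, `(1,1,λ₂,1)`, and vanishes to order two at `(λ₁,1,1,1)`
(it and all four partial derivatives vanish there). -/
theorem Q₂_vanishing {K : Type*} [Field K] (l1 l2 : K) :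
    eval ![1, 0, 0, 1] (Q₂ l1 l2) = 0 ∧
    eval ![1, 1, 0, 1] (Q₂ l1 l2) = 0 ∧
    eval ![0, 1, 1, 0] (Q₂ l1 l2) = 0 ∧
    eval ![1, 0, 1, 0] (Q₂ l1 l2) = 0 ∧
    eval ![1, 1, l2, 1] (Q₂ l1 l2) = 0 ∧
    eval ![l1, 1, 1, 1] (Q₂ l1 l2) = 0 ∧
    ∀ i : Fin 4, eval ![l1, 1, 1, 1] (pderiv i (Q₂ l1 l2)) = 0 := by
  refine ⟨?_, ?_, ?_, ?_, ?_, ?_, fun i => ?_⟩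
  case refine_7 =>
    simp only [Q₂, map_add, map_sub, Derivation.leibniz, Derivation.leibniz_pow, pderiv_C,
      pderiv_X]
    fin_cases i <;>
    · simp
      ring
  all_goals simp [Q₂]
  all_goals ring
end

section
/- Let K be a field of characteristic zero and let a, b, j₁, j₂ ∈ K satisfy 110592·a³ = −j₁j₂ and 746496·b² = (j₁−1728)(j₂−1728), with j₁ ≠ j₂. Then both cubic polynomials X³ + aX + b + 2 and X³ + aX + b − 2 in K[X] are separable (equivalently, each has nonzero discriminant −4a³ − 27(b±2)²). -/
open Polynomial

/-- A depressed cubic over a field with nonzero discriminant is separable. -/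
theorem separable_depressed_cubic {K : Type*} [Field K] (a c : K)
    (h : 4 * a ^ 3 + 27 * c ^ 2 ≠ 0) : (X ^ 3 + C a * X + C c).Separable := by
  have hD : C (4 * a ^ 3 + 27 * c ^ 2)⁻¹ * (4 * C a ^ 3 + 27 * C c ^ 2) = (1 : K[X]) := by
    have : (4 * C a ^ 3 + 27 * C c ^ 2 : K[X]) = C (4 * a ^ 3 + 27 * c ^ 2) := by
      simp only [map_add, map_mul, map_pow, map_ofNat]
    rw [this, ← C_mul, inv_mul_cancel₀ h, C_1]
  have hd : derivative (X ^ 3 + C a * X + C c) = 3 * X ^ 2 + C a := by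
    simp only [derivative_add, derivative_mul, derivative_X_pow, derivative_C, derivative_X,
      Nat.cast_ofNat, map_ofNat]
    ring
  rw [separable_def, hd]
  refine ⟨C (4 * a ^ 3 + 27 * c ^ 2)⁻¹ * (-18 * C a * X + 27 * C c),
    C (4 * a ^ 3 + 27 * c ^ 2)⁻¹ * (6 * C a * X ^ 2 - 9 * C c * X + 4 * C a ^ 2), ?_⟩
  linear_combination hD

theorem cubics_separable {K : Type*} [Field K] [CharZero K]
    (a b j1 j2 : K)
    (ha : 110592 * a ^ 3 = -(j1 * j2))
    (hb : 746496 * b ^ 2 = (j1 - 1728) * (j2 - 1728))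
    (hj : j1 ≠ j2) :
    (X ^ 3 + C a * X + C (b + 2)).Separable ∧
    (X ^ 3 + C a * X + C (b - 2)).Separable := by
  have key : ∀ e : K, e ^ 2 = 4 → 4 * a ^ 3 + 27 * (b + e) ^ 2 ≠ 0 := by
    intro e he h
    have hs : j1 + j2 = 864 * (4 + b * e) := by
      linear_combination (-(16 : K)) * h + (16 * 4 / 110592 : K) * ha +
        (16 * 27 / 746496 : K) * hb + 432 * he
    have hsq : (j1 - j2) ^ 2 = 0 := by
      linear_combination (j1 + j2 + 864 * (b * e) - 3456) * hs + 4 * hb + 864 ^ 2 * b ^ 2 * he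
    exact hj (sub_eq_zero.mp (pow_eq_zero_iff two_ne_zero |>.mp hsq))
  refine ⟨separable_depressed_cubic a _ (key 2 (by norm_num)), ?_⟩
  rw [sub_eq_add_neg]
  exact separable_depressed_cubic a _ (key (-2) (by norm_num))
end
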